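/- arXiv:2111.06206 — 11 statements merged into one kernel-verified Lean document; each statement's English description precedes it below -/
import Mathlib

section
/- Let N be a finite set with |N| = n ≥ 1 and v : Finset N → ℝ a set function, and let w denote the Harsanyi dividend of v. Then for every player i ∈ N, the Shapley value of i equals the sum of the Harsanyi dividends of all coalitions containing i, each divided uniformly among its members: φ(i) = Σ_{S ⊆ N \ {i}} (1 / (|S| + 1)) · w(S ∪ {i}). -/
open Finset in
theorem aux_coeff {N : Type*} [DecidableEq N] (K : Finset N) : ∀ t : ℕ,
    ∑ U ∈ K.powerset, (-1 : ℝ) ^ U.card * (1 / ((t : ℝ) + U.card + 1))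
      = ((t.factorial * K.card.factorial : ℕ) : ℝ) / ((t + K.card + 1).factorial : ℝ) := by
  induction K using Finset.induction_on with
  | empty =>
    intro t
    have : (t.factorial : ℝ) ≠ 0 := by positivity
    simp [Nat.factorial_succ]
    field_simp
  | insert a K ha ih =>
    intro t
    rw [Finset.sum_powerset_insert ha]
    have h2 : ∑ U ∈ K.powerset, (-1 : ℝ) ^ (insert a U).card *
        (1 / ((t : ℝ) + (insert a U).card + 1))
        = - ∑ U ∈ K.powerset, (-1 : ℝ) ^ U.card * (1 / (((t + 1 : ℕ) : ℝ) + U.card + 1)) := by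
      rw [← Finset.sum_neg_distrib]
      refine Finset.sum_congr rfl fun U hU => ?_
      have : a ∉ U := fun h => ha (Finset.mem_powerset.1 hU h)
      rw [Finset.card_insert_of_notMem this, pow_succ]
      push_cast
      ring
    rw [h2, ih, ih, Finset.card_insert_of_notMem ha]
    have e1 : t + 1 + K.card + 1 = (t + K.card + 1) + 1 := by ring
    have e2 : t + (K.card + 1) + 1 = (t + K.card + 1) + 1 := by ring
    rw [e1, e2, Nat.factorial_succ (t + K.card + 1), Nat.factorial_succ t,
      Nat.factorial_succ K.card]
    have : ((t + K.card + 1).factorial : ℝ) ≠ 0 := by positivity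
    have : (t : ℝ) + K.card + 1 + 1 ≠ 0 := by positivity
    push_cast
    field_simp
    ring

/-- **Connection between the Shapley value and the Harsanyi dividend.**
Let `n = |N| ≥ 1`, let `w` be the Harsanyi dividend of `v`, and let
`φ(i) = ∑_{S ⊆ N \ {i}} (|S|! (n-|S|-1)! / n!) (v(S∪{i}) - v(S))` be the Shapley
value of player `i`.  Then `φ(i) = ∑_{S ⊆ N \ {i}} (1/(|S|+1)) w(S ∪ {i})`. -/
theorem shapley_value_eq_sum_harsanyi {N : Type*} [Fintype N] [DecidableEq N]
    (v : Finset N → ℝ) (hn : 1 ≤ Fintype.card N)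
    (w : Finset N → ℝ)
    (hw : ∀ S : Finset N,
      w S = ∑ S' ∈ S.powerset, (-1 : ℝ) ^ (S.card - S'.card) * v S')
    (φ : N → ℝ)
    (hφ : ∀ i : N,
      φ i = ∑ S ∈ (Finset.univ.erase i).powerset,
        ((S.card.factorial * (Fintype.card N - S.card - 1).factorial : ℕ) : ℝ)
          / ((Fintype.card N).factorial : ℝ) * (v (insert i S) - v S)) :
    ∀ i : N,
      φ i = ∑ S ∈ (Finset.univ.erase i).powerset,
        (1 / ((S.card : ℝ) + 1)) * w (insert i S) := by
  intro i
  rw [hφ]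
  set M : Finset N := Finset.univ.erase i with hM
  have hMc : M.card + 1 = Fintype.card N := by
    rw [hM, Finset.card_erase_of_mem (Finset.mem_univ i), Finset.card_univ]
    omega
  have hiM : i ∉ M := by simp [hM]
  have hwi : ∀ S ∈ M.powerset, (1 / ((S.card : ℝ) + 1)) * w (insert i S)
      = ∑ T ∈ S.powerset, (1 / ((S.card : ℝ) + 1)) *
          ((-1 : ℝ) ^ (S.card - T.card) * (v (insert i T) - v T)) := by
    intro S hS
    have hiS : i ∉ S := fun h => hiM (Finset.mem_powerset.1 hS h)
    rw [hw, Finset.sum_powerset_insert hiS, ← Finset.sum_add_distrib, Finset.mul_sum]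
    refine Finset.sum_congr rfl fun T hT => ?_
    have hTS := Finset.mem_powerset.1 hT
    have hiT : i ∉ T := fun h => hiS (hTS h)
    have hc := Finset.card_le_card hTS
    rw [Finset.card_insert_of_notMem hiS, Finset.card_insert_of_notMem hiT,
      Nat.add_sub_add_right, Nat.sub_add_comm hc, pow_succ]
    ring
  rw [Finset.sum_congr rfl hwi]
  rw [Finset.sum_comm' (t' := M.powerset) (s' := fun T => M.powerset.filter (fun S => T ⊆ S))
    (by
      intro S T
      simp only [Finset.mem_powerset, Finset.mem_filter]
      exact ⟨fun h => ⟨⟨h.1, h.2⟩, h.2.trans h.1⟩, fun h => h.1⟩)]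
  refine Finset.sum_congr rfl fun T hT => ?_
  have hTM := Finset.mem_powerset.1 hT
  have hc := Finset.card_le_card hTM
  have key := aux_coeff (M \ T) T.card
  rw [Finset.card_sdiff_of_subset hTM] at key
  have e1 : T.card + (M.card - T.card) + 1 = Fintype.card N := by omega
  have e2 : Fintype.card N - T.card - 1 = M.card - T.card := by omega
  rw [e1] at key
  rw [e2, ← key, Finset.sum_mul]
  refine Finset.sum_bij' (fun U _ => T ∪ U) (fun S _ => S \ T) ?_ ?_ ?_ ?_ ?_
  · intro U hU
    have := Finset.mem_powerset.1 hU
    simp only [Finset.mem_filter, Finset.mem_powerset]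
    exact ⟨Finset.union_subset hTM (this.trans Finset.sdiff_subset), Finset.subset_union_left⟩
  · intro S hS
    simp only [Finset.mem_filter, Finset.mem_powerset] at hS ⊢
    exact Finset.sdiff_subset_sdiff hS.1 (Finset.Subset.refl _)
  · intro U hU
    have := Finset.mem_powerset.1 hU
    exact Finset.union_sdiff_cancel_left
      (Finset.disjoint_of_subset_right this Finset.disjoint_sdiff)
  · intro S hS
    simp only [Finset.mem_filter] at hS
    exact Finset.union_sdiff_of_subset hS.2
  · intro U hU
    have := Finset.mem_powerset.1 hU
    rw [Finset.card_union_of_disjoint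
      (Finset.disjoint_of_subset_right this Finset.disjoint_sdiff), Nat.add_sub_cancel_left]
    push_cast
    ring
end

section
/- Let N be a finite set with |N| = n and v : Finset N → ℝ a set function, and let w denote the Harsanyi dividend of v. Then for every coalition T ⊆ N, the Shapley interaction index of T can be represented as a weighted sum of Harsanyi dividends: I^Shapley(T) = Σ_{S ⊆ N \ T} (1 / (|S| + 1)) · w(S ∪ T). -/
theorem aux_beta {N : Type*} [DecidableEq N] (D : Finset N) : ∀ a : ℕ,
    ∑ B ∈ D.powerset, (-1 : ℝ) ^ B.card / ((a : ℝ) + B.card + 1)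
      = ((a.factorial * D.card.factorial : ℕ) : ℝ) / (((a + D.card + 1).factorial : ℕ) : ℝ) := by
  induction D using Finset.induction_on with
  | empty =>
    intro a
    have h : (a.factorial : ℝ) ≠ 0 := by positivity
    have h2 : (a : ℝ) + 1 ≠ 0 := by positivity
    simp [Nat.factorial_succ]
    field_simp
  | insert x D hx ih =>
    intro a
    rw [Finset.sum_powerset_insert hx]
    have e : ∑ B ∈ D.powerset, (-1 : ℝ) ^ (insert x B).card / ((a : ℝ) + (insert x B).card + 1)
        = - ∑ B ∈ D.powerset, (-1 : ℝ) ^ B.card / (((a + 1 : ℕ) : ℝ) + B.card + 1) := by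
      rw [← Finset.sum_neg_distrib]
      apply Finset.sum_congr rfl
      intro B hB
      have : x ∉ B := fun h => hx (Finset.mem_powerset.1 hB h)
      rw [Finset.card_insert_of_notMem this, pow_succ]
      push_cast
      rw [← neg_div]
      congr 1 <;> ring
    rw [e, ih a, ih (a + 1), Finset.card_insert_of_notMem hx,
      show a + 1 + D.card + 1 = (a + D.card + 1) + 1 by ring,
      show a + (D.card + 1) + 1 = (a + D.card + 1) + 1 by ring,
      Nat.factorial_succ (a + D.card + 1), Nat.factorial_succ a, Nat.factorial_succ D.card]
    have h : ((a + D.card + 1).factorial : ℝ) ≠ 0 := by positivity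
    have h2 : (a : ℝ) + D.card + 1 + 1 ≠ 0 := by positivity
    push_cast
    field_simp
    ring

theorem aux_swap {N : Type*} [DecidableEq N] (M : Finset N) (f : Finset N → Finset N → ℝ) :
    ∑ S ∈ M.powerset, ∑ A ∈ S.powerset, f S A
      = ∑ A ∈ M.powerset, ∑ B ∈ (M \ A).powerset, f (A ∪ B) A := by
  rw [Finset.sum_sigma', Finset.sum_sigma']
  refine Finset.sum_bij' (fun p _ => ⟨p.2, p.1 \ p.2⟩) (fun p _ => ⟨p.1 ∪ p.2, p.1⟩) ?_ ?_ ?_ ?_ ?_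
  · rintro ⟨S, A⟩ h
    simp only [Finset.mem_sigma, Finset.mem_powerset] at h ⊢
    exact ⟨h.2.trans h.1, Finset.sdiff_subset_sdiff h.1 le_rfl⟩
  · rintro ⟨A, B⟩ h
    simp only [Finset.mem_sigma, Finset.mem_powerset] at h ⊢
    exact ⟨Finset.union_subset h.1 (h.2.trans Finset.sdiff_subset), Finset.subset_union_left⟩
  · rintro ⟨S, A⟩ h
    simp only [Finset.mem_sigma, Finset.mem_powerset] at h ⊢
    rw [Finset.union_sdiff_of_subset h.2]
  · rintro ⟨A, B⟩ h
    simp only [Finset.mem_sigma, Finset.mem_powerset] at h ⊢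
    have : Disjoint A B := (Finset.subset_sdiff.1 h.2).2.symm
    rw [Finset.union_sdiff_cancel_left this]
  · rintro ⟨S, A⟩ h
    simp only [Finset.mem_sigma, Finset.mem_powerset] at h ⊢
    rw [Finset.union_sdiff_of_subset h.2]

theorem aux_split {N : Type*} [DecidableEq N] (S T : Finset N) (h : Disjoint S T)
    (v : Finset N → ℝ) :
    ∑ U ∈ (S ∪ T).powerset, (-1 : ℝ) ^ ((S ∪ T).card - U.card) * v U
      = ∑ A ∈ S.powerset, (-1 : ℝ) ^ (S.card - A.card) *
        ∑ T' ∈ T.powerset, (-1 : ℝ) ^ (T.card - T'.card) * v (T' ∪ A) := by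
  simp_rw [Finset.mul_sum]
  rw [← Finset.sum_product']
  symm
  refine Finset.sum_bij' (fun p _ => p.2 ∪ p.1) (fun U _ => (U ∩ S, U ∩ T)) ?_ ?_ ?_ ?_ ?_
  · rintro ⟨A, B⟩ hp
    simp only [Finset.mem_product, Finset.mem_powerset] at hp ⊢
    exact Finset.union_subset (hp.2.trans Finset.subset_union_right)
      (hp.1.trans Finset.subset_union_left)
  · intro U hU
    simp
  · rintro ⟨A, B⟩ hp
    simp only [Finset.mem_product, Finset.mem_powerset] at hp ⊢
    rw [Finset.disjoint_left] at h
    ext x <;> simp <;> grind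
  · intro U hU
    simp only [Finset.mem_powerset] at hU
    ext x
    grind
  · rintro ⟨A, B⟩ hp
    simp only [Finset.mem_product, Finset.mem_powerset] at hp ⊢
    have hd : Disjoint B A := (h.mono hp.1 hp.2).symm
    rw [Finset.card_union_of_disjoint h, Finset.card_union_of_disjoint hd, ← mul_assoc, ← pow_add]
    have h1 := Finset.card_le_card hp.1
    have h2 := Finset.card_le_card hp.2
    congr 2
    omega

/-- **Connection between the Shapley interaction index and the Harsanyi dividend.**
Let `n = |N|`, let `w` be the Harsanyi dividend of `v`, let
`Δv_T(S) = ∑_{T' ⊆ T} (-1)^(|T|-|T'|) v(T' ∪ S)` be the marginal benefit, and let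
`I^Shapley(T) = ∑_{S ⊆ N \ T} (|S|! (n-|S|-|T|)! / (n-|T|+1)!) Δv_T(S)`.
Then `I^Shapley(T) = ∑_{S ⊆ N \ T} (1/(|S|+1)) w(S ∪ T)`. -/
theorem shapley_interaction_eq_sum_harsanyi {N : Type*} [Fintype N] [DecidableEq N]
    (v : Finset N → ℝ)
    (w : Finset N → ℝ)
    (hw : ∀ S : Finset N,
      w S = ∑ S' ∈ S.powerset, (-1 : ℝ) ^ (S.card - S'.card) * v S')
    (Δv : Finset N → Finset N → ℝ)
    (hΔv : ∀ T S : Finset N,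
      Δv T S = ∑ T' ∈ T.powerset, (-1 : ℝ) ^ (T.card - T'.card) * v (T' ∪ S))
    (I : Finset N → ℝ)
    (hI : ∀ T : Finset N,
      I T = ∑ S ∈ ((Finset.univ : Finset N) \ T).powerset,
        ((S.card.factorial * (Fintype.card N - S.card - T.card).factorial : ℕ) : ℝ)
          / (((Fintype.card N - T.card + 1).factorial : ℕ) : ℝ) * Δv T S) :
    ∀ T : Finset N,
      I T = ∑ S ∈ ((Finset.univ : Finset N) \ T).powerset,
        (1 / ((S.card : ℝ) + 1)) * w (S ∪ T) := by
  intro T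
  have key : ∀ S ∈ ((Finset.univ : Finset N) \ T).powerset,
      (1 / ((S.card : ℝ) + 1)) * w (S ∪ T) = ∑ A ∈ S.powerset,
        (1 / ((S.card : ℝ) + 1)) * ((-1 : ℝ) ^ (S.card - A.card) * Δv T A) := by
    intro S hS
    have hd : Disjoint S T := (Finset.subset_sdiff.1 (Finset.mem_powerset.1 hS)).2
    rw [hw, aux_split S T hd v, Finset.mul_sum]
    simp_rw [hΔv]
  rw [hI, Finset.sum_congr rfl key, aux_swap]
  apply Finset.sum_congr rfl
  intro A hA
  have hA' := Finset.mem_powerset.1 hA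
  have hc : ((Finset.univ : Finset N) \ T).card = Fintype.card N - T.card := by
    rw [← Finset.compl_eq_univ_sdiff, Finset.card_compl]
  have hle := Finset.card_le_card hA'
  have hb := aux_beta (((Finset.univ : Finset N) \ T) \ A) A.card
  rw [Finset.card_sdiff_of_subset hA', hc] at hb
  rw [hc] at hle
  rw [show A.card + (Fintype.card N - T.card - A.card) + 1 = Fintype.card N - T.card + 1 by omega,
    show Fintype.card N - T.card - A.card = Fintype.card N - A.card - T.card by omega] at hb
  rw [← hb, Finset.sum_mul]
  apply Finset.sum_congr rfl
  intro B hB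
  have hd : Disjoint A B := (Finset.subset_sdiff.1 (Finset.mem_powerset.1 hB)).2.symm
  rw [Finset.card_union_of_disjoint hd, Nat.add_sub_cancel_left]
  push_cast
  ring
end

section
/- Let N be a finite set with |N| = n ≥ 1 and v : Finset N → ℝ a set function, let w denote the Harsanyi dividend of v, and let k ≥ 1. Then for every coalition T ⊆ N with |T| = k, the k-th order Shapley–Taylor interaction index of T satisfies I^{Shapley-Taylor(k)}(T) = Σ_{S ⊆ N \ T} (1 / C(|S| + k, k)) · w(S ∪ T), where C(·,·) denotes the binomial coefficient. -/
theorem st_aux_w {N : Type*} [DecidableEq N] (v : Finset N → ℝ) (a : N) (R : Finset N) (ha : a ∉ R) :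
    ∑ S' ∈ (insert a R).powerset, (-1 : ℝ) ^ ((insert a R).card - S'.card) * v S' =
    (∑ S' ∈ R.powerset, (-1 : ℝ) ^ (R.card - S'.card) * v (insert a S')) -
    ∑ S' ∈ R.powerset, (-1 : ℝ) ^ (R.card - S'.card) * v S' := by
  rw [Finset.sum_powerset_insert ha, sub_eq_neg_add, ← Finset.sum_neg_distrib]
  congr 1
  · refine Finset.sum_congr rfl fun S' hS => ?_
    have h := Finset.card_le_card (Finset.mem_powerset.1 hS)
    rw [Finset.card_insert_of_notMem ha, Nat.sub_add_comm h, pow_succ]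
    ring
  · refine Finset.sum_congr rfl fun S' hS => ?_
    have h : a ∉ S' := fun h => ha (Finset.mem_powerset.1 hS h)
    rw [Finset.card_insert_of_notMem ha, Finset.card_insert_of_notMem h, Nat.add_sub_add_right]

theorem st_aux_delta {N : Type*} [DecidableEq N] (T S : Finset N) (hd : Disjoint S T) :
    ∀ v : Finset N → ℝ,
    ∑ T' ∈ T.powerset, (-1 : ℝ) ^ (T.card - T'.card) * v (T' ∪ S) =
    ∑ R ∈ S.powerset, ∑ S' ∈ (R ∪ T).powerset, (-1 : ℝ) ^ ((R ∪ T).card - S'.card) * v S' := by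
  induction S using Finset.induction_on with
  | empty => intro v; simp
  | insert a S ha ih =>
    intro v
    rw [Finset.disjoint_insert_left] at hd
    have ih := ih hd.2 (fun X => v (insert a X))
    rw [Finset.sum_powerset_insert ha, ← Finset.sum_add_distrib]
    simp only [Finset.union_insert]
    rw [ih]
    refine Finset.sum_congr rfl fun R hR => ?_
    have h : a ∉ R ∪ T := by
      rw [Finset.mem_union]
      rintro (h | h)
      · exact ha (Finset.mem_powerset.1 hR h)
      · exact hd.1 h
    rw [Finset.insert_union, st_aux_w v a _ h]
    ring

theorem st_aux_binom {N : Type*} [DecidableEq N] (A : Finset N) : ∀ r k : ℕ,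
    ∑ S ∈ A.powerset, (1 : ℝ) / ((A.card + r + k).choose (r + S.card) : ℕ) =
      (A.card + r + k + 1 : ℝ) / ((k + 1) * ((r + (k + 1)).choose (k + 1) : ℕ)) := by
  induction A using Finset.induction_on with
  | empty =>
    intro r k
    have h := Nat.add_one_mul_choose_eq (r + k) k
    have h2 : (r + k).choose r = (r + k).choose k := Nat.choose_symm_add
    have h3 : (0 : ℝ) < ((r + k).choose k : ℕ) := by exact_mod_cast Nat.choose_pos (by omega)
    have h' : ((r : ℝ) + k + 1) * ((r + k).choose k : ℕ) = ((r + (k + 1)).choose (k + 1) : ℕ) * (k + 1) := by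
      exact_mod_cast h
    have h4 : (0 : ℝ) < r + k + 1 := by positivity
    simp only [Finset.powerset_empty, Finset.sum_singleton, Finset.card_empty, zero_add, add_zero, h2,
      Nat.cast_zero]
    rw [mul_comm ((k : ℝ) + 1), ← h']
    field_simp
  | insert a A ha ih =>
    intro r k
    rw [Finset.sum_powerset_insert ha, Finset.card_insert_of_notMem ha]
    have e1 := ih r (k + 1)
    have e2 := ih (r + 1) k
    have e3 : ∑ S ∈ A.powerset, (1 : ℝ) / ((A.card + 1 + r + k).choose (r + S.card) : ℕ) =
        ∑ S ∈ A.powerset, (1 : ℝ) / ((A.card + r + (k + 1)).choose (r + S.card) : ℕ) := by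
      rw [show A.card + 1 + r + k = A.card + r + (k + 1) by ring]
    have e4 : ∑ S ∈ A.powerset, (1 : ℝ) / ((A.card + 1 + r + k).choose (r + (insert a S).card) : ℕ) =
        ∑ S ∈ A.powerset, (1 : ℝ) / ((A.card + (r + 1) + k).choose (r + 1 + S.card) : ℕ) := by
      refine Finset.sum_congr rfl fun S hS => ?_
      have h : a ∉ S := fun h => ha (Finset.mem_powerset.1 hS h)
      rw [Finset.card_insert_of_notMem h, show A.card + 1 + r + k = A.card + (r + 1) + k by ring,
        show r + (S.card + 1) = r + 1 + S.card by ring]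
    rw [e3, e4, e1, e2]
    have h3 : (0 : ℝ) < ((r + (k + 1)).choose (k + 1) : ℕ) := by
      exact_mod_cast Nat.choose_pos (by omega)
    have a1 := Nat.add_one_mul_choose_eq (r + (k + 1)) (k + 1)
    have a2 := Nat.choose_mul_succ_eq (r + (k + 1)) (k + 1)
    rw [show r + (k + 1) + 1 - (k + 1) = r + 1 by omega] at a2
    rw [show r + 1 + (k + 1) = r + (k + 1) + 1 by ring, show r + (k + 1 + 1) = r + (k + 1) + 1 by ring]
    generalize (r + (k + 1)).choose (k + 1) = c at *
    generalize (r + (k + 1) + 1).choose (k + 1 + 1) = d at *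
    generalize (r + (k + 1) + 1).choose (k + 1) = e at *
    have b1 : (d : ℝ) = (r + k + 2) * c / (k + 2) := by
      rw [eq_div_iff (by positivity)]
      have : ((r + (k + 1) + 1 : ℕ) : ℝ) * c = d * ((k + 1 + 1 : ℕ) : ℝ) := by exact_mod_cast a1
      push_cast at this; linarith
    have b2 : (e : ℝ) = (r + k + 2) * c / (r + 1) := by
      rw [eq_div_iff (by positivity)]
      have : (c : ℝ) * ((r + (k + 1) + 1 : ℕ) : ℝ) = e * ((r + 1 : ℕ) : ℝ) := by exact_mod_cast a2
      push_cast at this; linarith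
    rw [b1, b2]
    push_cast
    have : (0 : ℝ) < r + k + 2 := by positivity
    have : (0 : ℝ) < (k : ℝ) + 1 + 1 := by positivity
    have : (0 : ℝ) < (k : ℝ) + 2 := by positivity
    field_simp
    ring

/-- **Connection between the Shapley–Taylor interaction index and the Harsanyi dividend.**
Let `n = |N| ≥ 1`, `k ≥ 1`, let `w` be the Harsanyi dividend of `v`, let
`Δv_T(S) = ∑_{T' ⊆ T} (-1)^(|T|-|T'|) v(T' ∪ S)` be the marginal benefit, and let
`I^{ST(k)}(T) = (k/n) ∑_{S ⊆ N \ T} (1 / C(n-1,|S|)) Δv_T(S)` for `|T| = k`.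
Then `I^{ST(k)}(T) = ∑_{S ⊆ N \ T} (1 / C(|S|+k,k)) w(S ∪ T)`. -/
theorem shapley_taylor_eq_sum_harsanyi {N : Type*} [Fintype N] [DecidableEq N]
    (v : Finset N → ℝ) (k : ℕ) (hk : 1 ≤ k) (hn : 1 ≤ Fintype.card N)
    (w : Finset N → ℝ)
    (hw : ∀ S : Finset N,
      w S = ∑ S' ∈ S.powerset, (-1 : ℝ) ^ (S.card - S'.card) * v S')
    (Δv : Finset N → Finset N → ℝ)
    (hΔv : ∀ T S : Finset N,
      Δv T S = ∑ T' ∈ T.powerset, (-1 : ℝ) ^ (T.card - T'.card) * v (T' ∪ S))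
    (I : Finset N → ℝ)
    (hI : ∀ T : Finset N,
      I T = ((k : ℝ) / (Fintype.card N : ℝ)) *
        ∑ S ∈ ((Finset.univ : Finset N) \ T).powerset,
          (1 / (((Fintype.card N - 1).choose S.card : ℕ) : ℝ)) * Δv T S) :
    ∀ T : Finset N, T.card = k →
      I T = ∑ S ∈ ((Finset.univ : Finset N) \ T).powerset,
        (1 / (((S.card + k).choose k : ℕ) : ℝ)) * w (S ∪ T) := by
  intro T hT
  obtain ⟨k, rfl⟩ : ∃ j, k = j + 1 := ⟨k - 1, by omega⟩
  rw [hI]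
  have hD : ∀ S ∈ ((Finset.univ : Finset N) \ T).powerset,
      (1 / (((Fintype.card N - 1).choose S.card : ℕ) : ℝ)) * Δv T S =
      ∑ R ∈ S.powerset, (1 / (((Fintype.card N - 1).choose S.card : ℕ) : ℝ)) * w (R ∪ T) := by
    intro S hS
    have hd : Disjoint S T :=
      Finset.disjoint_of_subset_left (Finset.mem_powerset.1 hS) Finset.sdiff_disjoint
    rw [hΔv, st_aux_delta T S hd v, Finset.mul_sum]
    simp only [hw]
  rw [Finset.sum_congr rfl hD]
  have hcomm : ∑ S ∈ ((Finset.univ : Finset N) \ T).powerset, ∑ R ∈ S.powerset,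
        (1 / (((Fintype.card N - 1).choose S.card : ℕ) : ℝ)) * w (R ∪ T) =
      ∑ R ∈ ((Finset.univ : Finset N) \ T).powerset,
        ∑ S ∈ Finset.Icc R ((Finset.univ : Finset N) \ T),
        (1 / (((Fintype.card N - 1).choose S.card : ℕ) : ℝ)) * w (R ∪ T) := by
    refine Finset.sum_comm' fun S R => ?_
    simp only [Finset.mem_powerset, Finset.mem_Icc, Finset.le_eq_subset]
    constructor
    · rintro ⟨h1, h2⟩
      exact ⟨⟨h2, h1⟩, h2.trans h1⟩
    · rintro ⟨⟨h1, h2⟩, _⟩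
      exact ⟨h2, h1⟩
  rw [hcomm, Finset.mul_sum]
  refine Finset.sum_congr rfl fun R hR => ?_
  have hR' := Finset.mem_powerset.1 hR
  rw [← Finset.sum_mul, ← mul_assoc]
  congr 1
  rw [Finset.Icc_eq_image_powerset hR', Finset.sum_image]
  · have hA := Finset.card_sdiff_add_card_eq_card hR'
    have hB := Finset.card_sdiff_add_card_eq_card (Finset.subset_univ T)
    rw [Finset.card_univ, hT] at hB
    have key := st_aux_binom ((Finset.univ \ T) \ R) R.card k
    have hc : Fintype.card N = ((Finset.univ \ T) \ R).card + R.card + k + 1 := by omega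
    have e : ∑ S ∈ ((Finset.univ \ T) \ R).powerset,
        (1 : ℝ) / ((Fintype.card N - 1).choose (R ∪ S).card : ℕ) =
        ∑ S ∈ ((Finset.univ \ T) \ R).powerset,
        (1 : ℝ) / ((((Finset.univ \ T) \ R).card + R.card + k).choose (R.card + S.card) : ℕ) := by
      refine Finset.sum_congr rfl fun S hS => ?_
      have hd : Disjoint R S :=
        Finset.disjoint_of_subset_right (Finset.mem_powerset.1 hS) Finset.disjoint_sdiff
      rw [Finset.card_union_of_disjoint hd, hc, Nat.add_sub_cancel]
    rw [e, key]
    have hc' : (Fintype.card N : ℝ) = ((Finset.univ \ T) \ R).card + R.card + k + 1 := by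
      exact_mod_cast hc
    rw [← hc']
    have h0 : (0 : ℝ) < Fintype.card N := by exact_mod_cast hn
    have h3 : (0 : ℝ) < ((R.card + (k + 1)).choose (k + 1) : ℕ) := by
      exact_mod_cast Nat.choose_pos (by omega)
    push_cast
    field_simp
  · intro S hS S' hS' h
    have d1 : Disjoint R S :=
      Finset.disjoint_of_subset_right (Finset.mem_powerset.1 hS) Finset.disjoint_sdiff
    have d2 : Disjoint R S' :=
      Finset.disjoint_of_subset_right (Finset.mem_powerset.1 hS') Finset.disjoint_sdiff
    have h : R ∪ S = R ∪ S' := h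
    rw [← Finset.union_sdiff_cancel_left d1, h, Finset.union_sdiff_cancel_left d2]
end

section
/- Let N be a finite set and v : Finset N → ℝ a set function, and let w denote the Harsanyi dividend of v. Then for any two disjoint coalitions T, S ⊆ N (T ⊆ N \ S), the marginal benefit of T given the environment S decomposes into the sum of the Harsanyi dividends of T joined with every sub-environment of S: Δv_T(S) = Σ_{S' ⊆ S} w(T ∪ S'). -/
/-- **Connection between the marginal benefit and the Harsanyi dividend.**
Let `w` be the Harsanyi dividend of `v`.  For disjoint coalitions `T` and `S`,
the marginal benefit `Δv_T(S) = ∑_{T' ⊆ T} (-1)^(|T|-|T'|) v(T' ∪ S)` decomposes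
as `Δv_T(S) = ∑_{S' ⊆ S} w(T ∪ S')`. -/
theorem marginal_benefit_eq_sum_harsanyi {N : Type*} [Fintype N] [DecidableEq N]
    (v : Finset N → ℝ)
    (w : Finset N → ℝ)
    (hw : ∀ S : Finset N,
      w S = ∑ S' ∈ S.powerset, (-1 : ℝ) ^ (S.card - S'.card) * v S') :
    ∀ T S : Finset N, Disjoint T S →
      (∑ T' ∈ T.powerset, (-1 : ℝ) ^ (T.card - T'.card) * v (T' ∪ S))
        = ∑ S' ∈ S.powerset, w (T ∪ S') := by
  intro T S
  induction S using Finset.induction_on generalizing T with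
  | empty => intro _; simp [hw]
  | insert a S ha ih =>
    intro h
    rw [Finset.disjoint_insert_right] at h
    obtain ⟨haT, hTS⟩ := h
    have h2 : Disjoint (insert a T) S := by
      rw [Finset.disjoint_insert_left]; exact ⟨ha, hTS⟩
    have e : ∀ S' : Finset N, T ∪ insert a S' = insert a T ∪ S' := by
      intro S'; simp
    rw [Finset.sum_powerset_insert ha]
    simp only [e]
    rw [← ih T hTS, ← ih (insert a T) h2, Finset.sum_powerset_insert haT, ← add_assoc,
      ← Finset.sum_add_distrib, ← Finset.sum_add_distrib]
    apply Finset.sum_congr rfl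
    intro T' hT'
    rw [Finset.mem_powerset] at hT'
    have hc := Finset.card_le_card hT'
    have haT' : a ∉ T' := fun h => haT (hT' h)
    rw [Finset.card_insert_of_notMem haT, Finset.card_insert_of_notMem haT',
      Nat.add_sub_add_right, Nat.succ_sub hc, pow_succ, Finset.union_insert, Finset.insert_union]
    ring
end

section
/- Let N be a finite set and v : Finset N → ℝ a set function, and let w denote the Harsanyi dividend of v. Then for any player i ∈ N and any coalition S ⊆ N \ {i}, the marginal benefit of the singleton {i} given the environment S satisfies v(S ∪ {i}) − v(S) = Σ_{L ⊆ S} w(L ∪ {i}). -/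
theorem harsanyi_step {N : Type*} [DecidableEq N] (v : Finset N → ℝ) (a : N) (L : Finset N)
    (ha : a ∉ L) :
    ∑ T ∈ (insert a L).powerset, (-1 : ℝ) ^ ((insert a L).card - T.card) * v T
      = ∑ T ∈ L.powerset, (-1 : ℝ) ^ (L.card - T.card) * v (insert a T)
        - ∑ T ∈ L.powerset, (-1 : ℝ) ^ (L.card - T.card) * v T := by
  rw [Finset.sum_powerset_insert ha, ← Finset.sum_add_distrib, ← Finset.sum_sub_distrib]
  refine Finset.sum_congr rfl fun T hT => ?_
  rw [Finset.mem_powerset] at hT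
  have hc := Finset.card_le_card hT
  rw [Finset.card_insert_of_notMem ha, Finset.card_insert_of_notMem (fun h => ha (hT h)),
    Nat.add_sub_add_right, Nat.sub_add_comm hc, pow_succ]
  ring

theorem harsanyi_inversion {N : Type*} [DecidableEq N] (S : Finset N) :
    ∀ v : Finset N → ℝ,
      ∑ L ∈ S.powerset, ∑ T ∈ L.powerset, (-1 : ℝ) ^ (L.card - T.card) * v T = v S := by
  induction S using Finset.induction_on with
  | empty => intro v; simp
  | insert a S ha ih =>
    intro v
    rw [Finset.sum_powerset_insert ha]
    rw [Finset.sum_congr rfl fun L hL =>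
      harsanyi_step v a L (fun h => ha (Finset.mem_powerset.mp hL h))]
    rw [Finset.sum_sub_distrib, ih v, ih (fun T => v (insert a T))]
    ring

/-- **Marginal benefit of a single player.**
Let `w` be the Harsanyi dividend of `v`.  For any player `i` and any coalition
`S ⊆ N \ {i}`, one has `v(S ∪ {i}) − v(S) = ∑_{L ⊆ S} w(L ∪ {i})`. -/
theorem marginal_singleton_eq_sum_harsanyi {N : Type*} [Fintype N] [DecidableEq N]
    (v : Finset N → ℝ)
    (w : Finset N → ℝ)
    (hw : ∀ S : Finset N,
      w S = ∑ S' ∈ S.powerset, (-1 : ℝ) ^ (S.card - S'.card) * v S') :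
    ∀ (i : N) (S : Finset N), i ∉ S →
      v (insert i S) - v S = ∑ L ∈ S.powerset, w (insert i L) := by
  intro i S hi
  have h1 := harsanyi_inversion (insert i S) v
  have h2 := harsanyi_inversion S v
  simp only [← hw] at h1 h2
  rw [Finset.sum_powerset_insert hi] at h1
  linarith
end

section
/- Dummy axiom: Let N be a finite set and v : Finset N → ℝ a set function, and let w denote the Harsanyi dividend of v. If a player i ∈ N is a dummy variable, i.e., for every S ⊆ N \ {i} one has v(S ∪ {i}) = v(S) + v({i}), then i has no interaction with other variables: for every nonempty S ⊆ N \ {i}, w(S ∪ {i}) = 0. -/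
/-- **Dummy axiom.**
Let `w` be the Harsanyi dividend of `v`.  If `i` is a dummy player, i.e.
`v(S ∪ {i}) = v(S) + v({i})` for every `S ⊆ N \ {i}`, then `i` has no interaction
with other variables: `w(S ∪ {i}) = 0` for every nonempty `S ⊆ N \ {i}`. -/
theorem harsanyi_dummy {N : Type*} [Fintype N] [DecidableEq N]
    (v : Finset N → ℝ) (i : N)
    (hdummy : ∀ S : Finset N, i ∉ S → v (insert i S) = v S + v {i})
    (w : Finset N → ℝ)
    (hw : ∀ S : Finset N,
      w S = ∑ S' ∈ S.powerset, (-1 : ℝ) ^ (S.card - S'.card) * v S') :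
    ∀ S : Finset N, i ∉ S → S.Nonempty → w (insert i S) = 0 := by
  intro S hi hS
  have h0 : (∑ m ∈ S.powerset, (-1 : ℝ) ^ m.card) = 0 := by
    exact_mod_cast congrArg (Int.cast : ℤ → ℝ) (Finset.sum_powerset_neg_one_pow_card_of_nonempty hS)
  rw [hw, Finset.sum_powerset_insert hi, ← Finset.sum_add_distrib]
  have h1 : ∀ T ∈ S.powerset,
      (-1 : ℝ) ^ ((insert i S).card - T.card) * v T
        + (-1 : ℝ) ^ ((insert i S).card - (insert i T).card) * v (insert i T)
      = ((-1 : ℝ) ^ S.card * v {i}) * (-1 : ℝ) ^ T.card := by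
    intro T hT
    have hTS := Finset.mem_powerset.mp hT
    have hiT : i ∉ T := fun h => hi (hTS h)
    obtain ⟨k, hk⟩ := Nat.exists_eq_add_of_le (Finset.card_le_card hTS)
    have e1 : T.card + k + 1 - T.card = k + 1 := by omega
    have e2 : T.card + k + 1 - (T.card + 1) = k := by omega
    have e3 : (-1 : ℝ) ^ T.card * (-1 : ℝ) ^ T.card = 1 := by
      rw [← mul_pow]; simp
    rw [Finset.card_insert_of_notMem hi, Finset.card_insert_of_notMem hiT, hdummy T hiT, hk,
      e1, e2, pow_add, pow_succ]
    linear_combination (-(-1 : ℝ) ^ k * v {i}) * e3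
  rw [Finset.sum_congr rfl h1, ← Finset.mul_sum, h0, mul_zero]
end

section
/- Symmetry axiom: Let N be a finite set and v : Finset N → ℝ a set function, and let w denote the Harsanyi dividend of v. If two players i, j ∈ N (i ≠ j) cooperate with other variables in the same manner, i.e., for every S ⊆ N \ {i, j} one has v(S ∪ {i}) = v(S ∪ {j}), then they have the same causal effects with other variables: for every S ⊆ N \ {i, j}, w(S ∪ {i}) = w(S ∪ {j}). -/
/-- **Symmetry axiom.**
Let `w` be the Harsanyi dividend of `v`.  If two distinct players `i, j`
cooperate with other variables in the same manner, i.e.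
`v(S ∪ {i}) = v(S ∪ {j})` for every `S ⊆ N \ {i, j}`, then they have the same
causal effects with other variables: `w(S ∪ {i}) = w(S ∪ {j})` for every
`S ⊆ N \ {i, j}`. -/
theorem harsanyi_symmetry {N : Type*} [Fintype N] [DecidableEq N]
    (v : Finset N → ℝ) (i j : N) (hij : i ≠ j)
    (hsym : ∀ S : Finset N, i ∉ S → j ∉ S → v (insert i S) = v (insert j S))
    (w : Finset N → ℝ)
    (hw : ∀ S : Finset N,
      w S = ∑ S' ∈ S.powerset, (-1 : ℝ) ^ (S.card - S'.card) * v S') :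
    ∀ S : Finset N, i ∉ S → j ∉ S → w (insert i S) = w (insert j S) := by
  intro S hi hj
  rw [hw, hw, Finset.sum_powerset_insert hi, Finset.sum_powerset_insert hj,
    Finset.card_insert_of_notMem hi, Finset.card_insert_of_notMem hj]
  congr 1
  refine Finset.sum_congr rfl fun T hT => ?_
  have hTS := Finset.mem_powerset.mp hT
  have h1 : i ∉ T := fun h => hi (hTS h)
  have h2 : j ∉ T := fun h => hj (hTS h)
  rw [Finset.card_insert_of_notMem h1, Finset.card_insert_of_notMem h2, hsym T h1 h2]
end

section
/- For all natural numbers n and l with n ≥ 1 and 0 ≤ l ≤ n − 1, the following binomial identity holds: Σ_{k=0}^{n−l−1} C(n − l − 1, k) / C(n − 1, l + k) = n / (l + 1), where C(·,·) denotes the binomial coefficient and the quotients are taken in ℝ. -/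
/-- **Binomial identity for the Shapley value weights.**
For natural numbers `n ≥ 1` and `l ≤ n − 1`,
`∑_{k=0}^{n−l−1} C(n−l−1, k) / C(n−1, l+k) = n / (l+1)` in `ℝ`. -/
theorem binomial_identity_shapley (n l : ℕ) (hn : 1 ≤ n) (hl : l ≤ n - 1) :
    ∑ k ∈ Finset.range (n - l - 1 + 1),
        (((n - l - 1).choose k : ℕ) : ℝ) / (((n - 1).choose (l + k) : ℕ) : ℝ)
      = (n : ℝ) / ((l : ℝ) + 1) := by
  obtain ⟨m, rfl⟩ : ∃ m, n = l + m + 1 := ⟨n - l - 1, by omega⟩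
  have e1 : l + m + 1 - l - 1 = m := by omega
  have e2 : l + m + 1 - 1 = l + m := by omega
  rw [e1, e2]
  have hpos : (((l + m).choose l : ℕ) : ℝ) ≠ 0 := by
    exact_mod_cast (Nat.choose_pos (by omega)).ne'
  have hterm : ∀ k ∈ Finset.range (m + 1),
      ((m.choose k : ℕ) : ℝ) / (((l + m).choose (l + k) : ℕ) : ℝ)
        = (((k + l).choose l : ℕ) : ℝ) / (((l + m).choose l : ℕ) : ℝ) := by
    intro k hk
    have hk' : k ≤ m := by simpa [Nat.lt_succ_iff] using hk
    have h2 : (((l + m).choose (l + k) : ℕ) : ℝ) ≠ 0 := by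
      exact_mod_cast (Nat.choose_pos (by omega)).ne'
    have h := Nat.choose_mul (n := l + m) (k := l + k) (s := l) (by omega)
    rw [Nat.add_sub_cancel_left, Nat.add_sub_cancel_left] at h
    rw [div_eq_div_iff h2 hpos, add_comm k l]
    have h' : (((l + m).choose (l + k) : ℕ) : ℝ) * (((l + k).choose l : ℕ) : ℝ)
        = (((l + m).choose l : ℕ) : ℝ) * ((m.choose k : ℕ) : ℝ) := by exact_mod_cast h
    linarith
  rw [Finset.sum_congr rfl hterm, ← Finset.sum_div, ← Nat.cast_sum,
    Nat.sum_range_add_choose]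
  have hl1 : (l : ℝ) + 1 ≠ 0 := by positivity
  rw [div_eq_div_iff hpos hl1, add_comm m l]
  exact_mod_cast (Nat.add_one_mul_choose_eq (l + m) l).symm
end

section
/- For all natural numbers n, t, l with 0 ≤ t ≤ n and 0 ≤ l ≤ n − t, the following binomial identity holds: Σ_{k=0}^{n−l−t} C(n − l − t, k) / C(n − t, l + k) = (n − t + 1) / (l + 1), where C(·,·) denotes the binomial coefficient and the quotients are taken in ℝ. -/
/-- **Binomial identity for the Shapley interaction index weights.**
For natural numbers `t ≤ n` and `l ≤ n − t`,
`∑_{k=0}^{n−l−t} C(n−l−t, k) / C(n−t, l+k) = (n−t+1) / (l+1)` in `ℝ`. -/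
theorem binomial_identity_shapley_interaction (n t l : ℕ) (ht : t ≤ n) (hl : l ≤ n - t) :
    ∑ k ∈ Finset.range (n - l - t + 1),
        (((n - l - t).choose k : ℕ) : ℝ) / (((n - t).choose (l + k) : ℕ) : ℝ)
      = (((n - t : ℕ) : ℝ) + 1) / ((l : ℝ) + 1) := by
  obtain ⟨p, hp⟩ := Nat.exists_eq_add_of_le hl
  have h1 : n - l - t = p := by omega
  rw [h1, hp]
  have hpos : (((l + p).choose l : ℕ) : ℝ) ≠ 0 := by
    exact_mod_cast (Nat.choose_pos (Nat.le_add_right l p)).ne'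
  have hterm : ∀ k ∈ Finset.range (p + 1),
      ((p.choose k : ℕ) : ℝ) / (((l + p).choose (l + k) : ℕ) : ℝ)
        = (((k + l).choose l : ℕ) : ℝ) / (((l + p).choose l : ℕ) : ℝ) := by
    intro k hk
    have hk' : k ≤ p := by simpa [Nat.lt_succ_iff] using hk
    have h2 : (((l + p).choose (l + k) : ℕ) : ℝ) ≠ 0 := by
      exact_mod_cast (Nat.choose_pos (Nat.add_le_add_left hk' l)).ne'
    have h3 := Nat.choose_mul (n := l + p) (k := l + k) (s := l) (Nat.le_add_right l k)
    rw [Nat.add_sub_cancel_left, Nat.add_sub_cancel_left] at h3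
    rw [div_eq_div_iff h2 hpos, add_comm k l]
    have h4 : (((l + p).choose (l + k) : ℕ) : ℝ) * (((l + k).choose l : ℕ) : ℝ)
        = (((l + p).choose l : ℕ) : ℝ) * ((p.choose k : ℕ) : ℝ) := by exact_mod_cast h3
    linarith
  rw [Finset.sum_congr rfl hterm, ← Finset.sum_div, ← Nat.cast_sum, Nat.sum_range_add_choose]
  have hl0 : ((l : ℝ) + 1) ≠ 0 := by positivity
  rw [div_eq_div_iff hpos hl0]
  have h5 := Nat.add_one_mul_choose_eq (l + p) l
  rw [add_comm p l]
  exact_mod_cast h5.symm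
end

section
/- For all natural numbers M ≥ 0 and l ≥ 1, the following identity holds: Σ_{k=0}^{M} C(M, k) · B(M + 1 − k, l + k) = 1 / l, where C(·,·) denotes the binomial coefficient and B(p, q) = ∫_0^1 x^{p−1} (1 − x)^{q−1} dx denotes the Beta function. -/
/-- The Beta function `B(p, q) = ∫_0^1 x^(p−1) (1−x)^(q−1) dx`. -/
noncomputable def betaFn (p q : ℝ) : ℝ :=
  ∫ x in (0 : ℝ)..1, x ^ (p - 1) * (1 - x) ^ (q - 1)

/-- **Beta-function identity ①.**
For natural numbers `M ≥ 0` and `l ≥ 1`,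
`∑_{k=0}^{M} C(M, k) · B(M+1−k, l+k) = 1 / l`. -/
theorem beta_binomial_sum_one (M l : ℕ) (hl : 1 ≤ l) :
    ∑ k ∈ Finset.range (M + 1),
        ((M.choose k : ℕ) : ℝ) * betaFn ((M : ℝ) + 1 - (k : ℝ)) ((l : ℝ) + (k : ℝ))
      = 1 / (l : ℝ) := by
  obtain ⟨n, rfl⟩ : ∃ n, l = n + 1 := ⟨l - 1, by omega⟩
  have h1 : ∀ k ∈ Finset.range (M + 1),
      ((M.choose k : ℕ) : ℝ) * betaFn ((M : ℝ) + 1 - (k : ℝ)) (((n + 1 : ℕ) : ℝ) + (k : ℝ))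
      = ∫ x in (0 : ℝ)..1, (M.choose k : ℝ) * (x ^ (M - k) * (1 - x) ^ (n + k)) := by
    intro k hk
    have hk' : k ≤ M := by
      have := Finset.mem_range.mp hk
      omega
    rw [intervalIntegral.integral_const_mul, betaFn]
    congr 2
    funext x
    have e1 : (M : ℝ) + 1 - (k : ℝ) - 1 = ((M - k : ℕ) : ℝ) := by
      rw [Nat.cast_sub hk']; ring
    have e2 : ((n + 1 : ℕ) : ℝ) + (k : ℝ) - 1 = ((n + k : ℕ) : ℝ) := by
      push_cast; ring
    rw [e1, e2, Real.rpow_natCast, Real.rpow_natCast]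
  rw [Finset.sum_congr rfl h1, ← intervalIntegral.integral_finset_sum]
  · have h2 : ∀ x : ℝ, ∑ k ∈ Finset.range (M + 1),
        (M.choose k : ℝ) * (x ^ (M - k) * (1 - x) ^ (n + k)) = (1 - x) ^ n := by
      intro x
      have h := add_pow (1 - x) x M
      rw [sub_add_cancel, one_pow] at h
      calc _ = (1 - x) ^ n * ∑ k ∈ Finset.range (M + 1),
            (1 - x) ^ k * x ^ (M - k) * (M.choose k : ℝ) := by
              rw [Finset.mul_sum]
              refine Finset.sum_congr rfl fun k _ => ?_
              rw [pow_add]; ring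
        _ = _ := by rw [← h, mul_one]
    simp only [h2]
    rw [intervalIntegral.integral_comp_sub_left (fun x : ℝ => x ^ n) 1]
    simp
  · intro k _
    exact Continuous.intervalIntegrable (by fun_prop) _ _
end

section
/- For all natural numbers M ≥ 0 and l ≥ 1, the following identity holds: Σ_{k=0}^{M} k · C(M, k) · B(M + 1 − k, l + k) = M / (l + 1), where C(·,·) denotes the binomial coefficient and B(p, q) = ∫_0^1 x^{p−1} (1 − x)^{q−1} dx denotes the Beta function. -/
theorem betaFn_nat_aux (a b : ℕ) (p q : ℝ) (hp : p - 1 = a) (hq : q - 1 = b) :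
    betaFn p q = ∫ x in (0 : ℝ)..1, x ^ a * (1 - x) ^ b := by
  simp only [betaFn, hp, hq, Real.rpow_natCast]

theorem bern_aux (M : ℕ) (x : ℝ) :
    ∑ k ∈ Finset.range (M + 1), (k : ℝ) * (M.choose k : ℝ) * (x ^ (M - k) * (1 - x) ^ k)
      = M * (1 - x) := by
  have h := congrArg (Polynomial.eval (1 - x)) (bernsteinPolynomial.sum_smul ℝ M)
  simp only [bernsteinPolynomial, Polynomial.eval_finsetSum, nsmul_eq_mul, Polynomial.eval_mul,
    Polynomial.eval_natCast, Polynomial.eval_pow, Polynomial.eval_X, Polynomial.eval_sub,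
    Polynomial.eval_one, sub_sub_cancel] at h
  rw [← h]
  exact Finset.sum_congr rfl fun k _ => by ring

/-- **Beta-function identity ②.**
For natural numbers `M ≥ 0` and `l ≥ 1`,
`∑_{k=0}^{M} k · C(M, k) · B(M+1−k, l+k) = M / (l+1)`. -/
theorem beta_binomial_sum_two (M l : ℕ) (hl : 1 ≤ l) :
    ∑ k ∈ Finset.range (M + 1),
        (k : ℝ) * ((M.choose k : ℕ) : ℝ) *
          betaFn ((M : ℝ) + 1 - (k : ℝ)) ((l : ℝ) + (k : ℝ))
      = (M : ℝ) / ((l : ℝ) + 1) := by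
  obtain ⟨m, rfl⟩ : ∃ m, l = m + 1 := ⟨l - 1, by omega⟩
  have h1 : ∀ k ∈ Finset.range (M + 1),
      (k : ℝ) * ((M.choose k : ℕ) : ℝ) *
          betaFn ((M : ℝ) + 1 - (k : ℝ)) (((m + 1 : ℕ) : ℝ) + (k : ℝ))
      = ∫ x in (0 : ℝ)..1, (k : ℝ) * (M.choose k : ℝ) * (x ^ (M - k) * (1 - x) ^ (m + k)) := by
    intro k hk
    have hk' : k ≤ M := by simpa [Nat.lt_succ_iff] using hk
    rw [betaFn_nat_aux (M - k) (m + k), intervalIntegral.integral_const_mul]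
    · push_cast [hk']; ring
    · push_cast; ring
  rw [Finset.sum_congr rfl h1, ← intervalIntegral.integral_finset_sum]
  · have h2 : ∀ x : ℝ, ∑ k ∈ Finset.range (M + 1),
        (k : ℝ) * (M.choose k : ℝ) * (x ^ (M - k) * (1 - x) ^ (m + k))
        = M * (1 - x) ^ (m + 1) := by
      intro x
      rw [pow_succ', ← mul_assoc, ← bern_aux, Finset.sum_mul]
      exact Finset.sum_congr rfl fun k _ => by ring
    simp only [h2]
    rw [intervalIntegral.integral_const_mul,
      intervalIntegral.integral_comp_sub_left (fun x : ℝ => x ^ (m + 1)) 1, integral_pow]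
    simp
    ring
  · intro k _
    exact Continuous.intervalIntegrable (by fun_prop) _ _
end
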